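/- The matrix K(λ) = (λ - cλ⁻¹)I + [[S₃, S₁], [S₂, -S₃]], where S₁, S₂, S₃ satisfy the Poisson relations {S₃,S₁} = S₁, {S₃,S₂} = -S₂, {S₁,S₂} = 2S₃ and S₁S₂ + S₃² is Poisson-central (e.g. constant), satisfies the dynamical reflection equation {K₁(λ), K₂(μ)} = [r(λ-μ), K₁(λ)K₂(μ)] + K₁(λ)r(λ+μ)K₂(μ) - K₂(μ)r(λ+μ)K₁(λ), where r(λ) = (1/(2λ))·(permutation-type matrix diag-blocks [[1,0,0,0],[0,0,1,0],[0,1,0,0],[0,0,0,1]]), K₁ = K ⊗ I, K₂ = I ⊗ K, and the Poisson bracket of matrices is taken entrywise. -/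

import Mathlib

open Matrix Kronecker

/-- The boundary matrix `K(λ) = (λ - cλ⁻¹)I + [[S₃, S₁], [S₂, -S₃]]` over a Poisson
algebra `A` containing the dynamical variables `S₁, S₂, S₃`. -/
noncomputable def Kabs {A : Type*} [CommRing A] [Algebra ℂ A] (c : ℝ)
    (S₁ S₂ S₃ : A) (lam : ℂ) : Matrix (Fin 2) (Fin 2) A :=
  algebraMap ℂ A (lam - (c : ℂ) * lam⁻¹) • (1 : Matrix (Fin 2) (Fin 2) A)
    + !![S₃, S₁; S₂, -S₃]

/-- The classical `r`-matrix `r(λ) = (1/(2λ)) [[1,0,0,0],[0,0,1,0],[0,1,0,0],[0,0,0,1]]`,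
indexed by `(Fin 2 × Fin 2)` and regarded with entries in `A`. -/
noncomputable def rmat (A : Type*) [CommRing A] [Algebra ℂ A] (lam : ℂ) :
    Matrix (Fin 2 × Fin 2) (Fin 2 × Fin 2) A :=
  Matrix.of fun p q =>
    if p.1 = q.2 ∧ p.2 = q.1 then algebraMap ℂ A (1 / (2 * lam)) else 0

/-- if `S₁, S₂, S₃` in a Poisson algebra satisfy the sl(2) brackets
`{S₃,S₁} = S₁`, `{S₃,S₂} = -S₂`, `{S₁,S₂} = 2S₃` and the Casimir `S₁S₂ + S₃²` is
Poisson-central, then `K(λ)` satisfies the dynamical reflection equation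
`{K₁(λ), K₂(μ)} = [r(λ-μ), K₁(λ)K₂(μ)] + K₁(λ)r(λ+μ)K₂(μ) - K₂(μ)r(λ+μ)K₁(λ)`,
the bracket of matrices being taken entrywise:
`{K₁(λ), K₂(μ)}_{(i,k),(j,l)} = {K(λ)_{ij}, K(μ)_{kl}}`. -/
theorem stmt_13 {A : Type*} [CommRing A] [Algebra ℂ A]
    (P : A → A → A)
    -- the Poisson bracket: bilinear, antisymmetric, Leibniz
    (Paddl : ∀ a b d : A, P (a + b) d = P a d + P b d)
    (Paddr : ∀ a b d : A, P a (b + d) = P a b + P a d)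
    (Psmull : ∀ (z : ℂ) (a b : A), P (z • a) b = z • P a b)
    (Psmulr : ∀ (z : ℂ) (a b : A), P a (z • b) = z • P a b)
    (Panti : ∀ a b : A, P a b = -P b a)
    (Pleib : ∀ a b d : A, P a (b * d) = P a b * d + b * P a d)
    (c : ℝ) (S₁ S₂ S₃ : A)
    -- the sl(2) Poisson brackets
    (h31 : P S₃ S₁ = S₁) (h32 : P S₃ S₂ = -S₂) (h12 : P S₁ S₂ = 2 * S₃)
    -- the Casimir S₁S₂ + S₃² is Poisson-central
    (hcas : ∀ a : A, P (S₁ * S₂ + S₃ * S₃) a = 0)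
    (lam mu : ℂ) (hlam : lam ≠ 0) (hmu : mu ≠ 0)
    (hne : lam ≠ mu) (hne' : lam ≠ -mu) :
    Matrix.kroneckerMap P (Kabs c S₁ S₂ S₃ lam) (Kabs c S₁ S₂ S₃ mu)
      = (rmat A (lam - mu)
            * ((Kabs c S₁ S₂ S₃ lam ⊗ₖ (1 : Matrix (Fin 2) (Fin 2) A))
              * ((1 : Matrix (Fin 2) (Fin 2) A) ⊗ₖ Kabs c S₁ S₂ S₃ mu))
          - ((Kabs c S₁ S₂ S₃ lam ⊗ₖ (1 : Matrix (Fin 2) (Fin 2) A))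
              * ((1 : Matrix (Fin 2) (Fin 2) A) ⊗ₖ Kabs c S₁ S₂ S₃ mu))
            * rmat A (lam - mu))
        + (Kabs c S₁ S₂ S₃ lam ⊗ₖ (1 : Matrix (Fin 2) (Fin 2) A))
            * rmat A (lam + mu)
            * ((1 : Matrix (Fin 2) (Fin 2) A) ⊗ₖ Kabs c S₁ S₂ S₃ mu)
        - ((1 : Matrix (Fin 2) (Fin 2) A) ⊗ₖ Kabs c S₁ S₂ S₃ mu)
            * rmat A (lam + mu)
            * (Kabs c S₁ S₂ S₃ lam ⊗ₖ (1 : Matrix (Fin 2) (Fin 2) A)) := by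
  have P1r : ∀ a, P a 1 = 0 := by
    intro a
    have h := Pleib a 1 1
    simp only [mul_one, one_mul] at h
    exact left_eq_add.mp h
  have P1l : ∀ a, P 1 a = 0 := by
    intro a
    rw [Panti, P1r, neg_zero]
  have Pal : ∀ (z : ℂ) (a : A), P (algebraMap ℂ A z) a = 0 := by
    intro z a
    rw [Algebra.algebraMap_eq_smul_one, Psmull, P1l, smul_zero]
  have Par : ∀ (z : ℂ) (a : A), P a (algebraMap ℂ A z) = 0 := by
    intro z a
    rw [Algebra.algebraMap_eq_smul_one, Psmulr, P1r, smul_zero]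
  have Pnl : ∀ a b : A, P (-a) b = - P a b := by
    intro a b
    have h := Psmull (-1) a b
    simpa using h
  have Pnr : ∀ a b : A, P a (-b) = - P a b := by
    intro a b
    have h := Psmulr (-1) a b
    simpa using h
  have P0r : ∀ a, P a 0 = 0 := by
    intro a
    simpa using Psmulr 0 a 0
  have P0l : ∀ a, P 0 a = 0 := by
    intro a
    simpa using Psmull 0 0 a
  have Pself : ∀ a, P a a = 0 := by
    intro a
    have h : P a a + P a a = 0 := by
      nth_rewrite 1 [Panti a a]
      exact neg_add_cancel _
    have h2 : ((1 / 2 : ℂ) * 2) • P a a = 0 := by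
      rw [mul_smul, two_smul, h, smul_zero]
    simpa using h2
  have h13 : P S₁ S₃ = -S₁ := by rw [Panti, h31]
  have h23 : P S₂ S₃ = S₂ := by rw [Panti, h32, neg_neg]
  have h21 : P S₂ S₁ = -(2 * S₃) := by rw [Panti, h12]
  have hm : lam - mu ≠ 0 := sub_ne_zero.mpr hne
  have hp : lam + mu ≠ 0 := fun h => hne' (eq_neg_of_add_eq_zero_left h)
  have key : algebraMap ℂ A (1 / (2 * (lam - mu))) *
        (algebraMap ℂ A (lam - (c : ℂ) * lam⁻¹) - algebraMap ℂ A (mu - (c : ℂ) * mu⁻¹))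
      + algebraMap ℂ A (1 / (2 * (lam + mu))) *
        (algebraMap ℂ A (lam - (c : ℂ) * lam⁻¹) + algebraMap ℂ A (mu - (c : ℂ) * mu⁻¹)) = 1 := by
    rw [← map_sub, ← map_add, ← map_mul, ← map_mul, ← map_add, ← map_one (algebraMap ℂ A)]
    congr 1
    field_simp
    ring
  unfold Kabs rmat
  generalize algebraMap ℂ A (1 / (2 * (lam - mu))) = x at *
  generalize algebraMap ℂ A (1 / (2 * (lam + mu))) = y at *
  have ha := Pal (lam - (c : ℂ) * lam⁻¹)
  have ha' := Par (lam - (c : ℂ) * lam⁻¹)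
  have hb := Pal (mu - (c : ℂ) * mu⁻¹)
  have hb' := Par (mu - (c : ℂ) * mu⁻¹)
  generalize algebraMap ℂ A (lam - (c : ℂ) * lam⁻¹) = a at *
  generalize algebraMap ℂ A (mu - (c : ℂ) * mu⁻¹) = b at *
  clear Pal Par Pleib Psmull Psmulr hcas
  ext ⟨i, k⟩ ⟨j, l⟩
  fin_cases i <;> fin_cases k <;> fin_cases j <;> fin_cases l <;>
    simp [Matrix.mul_apply, Fintype.sum_prod_type, Matrix.one_apply, Paddl, Paddr, Pnl, Pnr,
      P0l, P0r, ha, ha', hb, hb', Pself, h13, h23, h21, h31, h32, h12] <;>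
    first
    | ring1
    | linear_combination S₁ * key
    | linear_combination (-S₁) * key
    | linear_combination S₂ * key
    | linear_combination (-S₂) * key
    | linear_combination (2 * S₃) * key
    | linear_combination (-2 * S₃) * key
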